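/- arXiv:math/0302299 — 2 statements merged into one kernel-verified Lean document; each statement's English description precedes it below -/
import Mathlib

section
/- Let n ≥ 1 and let M, K : ℝⁿ × ℝ² → ℝ^{n×n} and D : ℝⁿ × ℝ² → ℝⁿ be smooth (C^∞), with arguments (z,x,t). Suppose that for all (z,x,t) and all μ, ν, τ ∈ {1,…,n}: (i) M_{μν} + M_{νμ} = 0 and K_{μν} + K_{νμ} = 0; (ii) ∂M_{μν}/∂z^τ + ∂M_{ντ}/∂z^μ + ∂M_{τμ}/∂z^ν = 0 and ∂K_{μν}/∂z^τ + ∂K_{ντ}/∂z^μ + ∂K_{τμ}/∂z^ν = 0; (iii) ∂M_{μν}/∂t + ∂K_{μν}/∂x = ∂D_μ/∂z^ν − ∂D_ν/∂z^μ. Then there exist smooth F, G : ℝⁿ × ℝ² → ℝⁿ and B : ℝⁿ × ℝ² → ℝ such that for all (z,x,t): M_{μν} = ∂F_ν/∂z^μ − ∂F_μ/∂z^ν, K_{μν} = ∂G_ν/∂z^μ − ∂G_μ/∂z^ν, and D_μ = −(∂B/∂z^μ + ∂F_μ/∂t + ∂G_μ/∂x); that is, the first-order system M_{μν} z^ν_t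 + K_{μν} z^ν_x + D_μ = 0 is of multi-symplectic Birkhoffian type. -/
/-- Partial derivative of `f : ℝⁿ × ℝ² → ℝ` (arguments `(z, x, t)`) in the `μ`-th
component of its `z` argument, at the point `P`. -/
noncomputable def pderZ (n : ℕ) (f : (Fin n → ℝ) × ℝ × ℝ → ℝ) (μ : Fin n)
    (P : (Fin n → ℝ) × ℝ × ℝ) : ℝ :=
  deriv (fun s => f (Function.update P.1 μ s, P.2)) (P.1 μ)

/-- Partial derivative of `f : ℝⁿ × ℝ² → ℝ` (arguments `(z, x, t)`) in the
explicit `x` argument, at the point `P`. -/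
noncomputable def pderX (n : ℕ) (f : (Fin n → ℝ) × ℝ × ℝ → ℝ)
    (P : (Fin n → ℝ) × ℝ × ℝ) : ℝ :=
  deriv (fun s => f (P.1, s, P.2.2)) P.2.1

/-- Partial derivative of `f : ℝⁿ × ℝ² → ℝ` (arguments `(z, x, t)`) in the
explicit `t` argument, at the point `P`. -/
noncomputable def pderT (n : ℕ) (f : (Fin n → ℝ) × ℝ × ℝ → ℝ)
    (P : (Fin n → ℝ) × ℝ × ℝ) : ℝ :=
  deriv (fun s => f (P.1, P.2.1, s)) P.2.2


lemma hasFDerivAt_pint {E : Type*} [NormedAddCommGroup E] [NormedSpace ℝ E]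
    [FiniteDimensional ℝ E] (f : E × ℝ → ℝ) (hf : ContDiff ℝ (⊤ : ℕ∞) f) (P : E) :
    HasFDerivAt (fun P => ∫ s in (0:ℝ)..1, f (P, s))
      (∫ s in (0:ℝ)..1, (fderiv ℝ f (P, s)).comp (ContinuousLinearMap.inl ℝ E ℝ)) P := by
  have hfc := hf.continuous
  have hdc : Continuous (fun q : E × ℝ => (fderiv ℝ f q).comp (ContinuousLinearMap.inl ℝ E ℝ)) :=
    (hf.continuous_fderiv (by simp)).clm_comp continuous_const
  have : ProperSpace E := FiniteDimensional.proper_real E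
  have hcomp : IsCompact (Metric.closedBall P 1 ×ˢ Set.Icc (0:ℝ) 1) :=
    (isCompact_closedBall P 1).prod isCompact_Icc
  obtain ⟨C, hC⟩ := hcomp.exists_bound_of_continuousOn hdc.continuousOn
  refine intervalIntegral.hasFDerivAt_integral_of_dominated_of_fderiv_le
    (F := fun P s => f (P, s))
    (F' := fun P s => (fderiv ℝ f (P, s)).comp (ContinuousLinearMap.inl ℝ E ℝ))
    (bound := fun _ => C) (Metric.closedBall_mem_nhds P one_pos) ?_ ?_ ?_ ?_ ?_ ?_
  · exact Filter.Eventually.of_forall fun x =>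
      (hfc.comp (by fun_prop : Continuous fun s : ℝ => (x, s))).aestronglyMeasurable
  · exact (hfc.comp (by fun_prop : Continuous fun s : ℝ => (P, s))).intervalIntegrable _ _
  · exact (hdc.comp (by fun_prop : Continuous fun s : ℝ => (P, s))).aestronglyMeasurable
  · refine Filter.Eventually.of_forall fun t ht x hx => hC (x, t) ⟨hx, ?_⟩
    rw [Set.uIoc_of_le zero_le_one] at ht
    exact ⟨ht.1.le, ht.2⟩
  · exact intervalIntegrable_const
  · refine Filter.Eventually.of_forall fun t ht x hx => ?_
    have h1 : HasFDerivAt f (fderiv ℝ f (x, t)) (x, t) :=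
      (hf.differentiable (by simp) _).hasFDerivAt
    exact h1.comp x (hasFDerivAt_prodMk_left x t)

lemma fderiv_pint {E : Type*} [NormedAddCommGroup E] [NormedSpace ℝ E]
    [FiniteDimensional ℝ E] (f : E × ℝ → ℝ) (hf : ContDiff ℝ (⊤ : ℕ∞) f) (P v : E) :
    fderiv ℝ (fun P => ∫ s in (0:ℝ)..1, f (P, s)) P v =
      ∫ s in (0:ℝ)..1, fderiv ℝ f (P, s) (v, 0) := by
  have hdc : Continuous (fun s : ℝ => (fderiv ℝ f (P, s)).comp (ContinuousLinearMap.inl ℝ E ℝ)) :=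
    ((hf.continuous_fderiv (by simp)).comp
      (by fun_prop : Continuous fun s : ℝ => (P, s))).clm_comp continuous_const
  rw [(hasFDerivAt_pint f hf P).fderiv,
    ContinuousLinearMap.intervalIntegral_apply (hdc.intervalIntegrable _ _)]
  simp

lemma contDiff_pint {E : Type*} [NormedAddCommGroup E] [NormedSpace ℝ E]
    [FiniteDimensional ℝ E] (f : E × ℝ → ℝ) (hf : ContDiff ℝ (⊤ : ℕ∞) f) :
    ContDiff ℝ (⊤ : ℕ∞) (fun P => ∫ s in (0:ℝ)..1, f (P, s)) := by
  rw [contDiff_infty]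
  intro k
  induction k generalizing f with
  | zero =>
    have : Differentiable ℝ (fun P => ∫ s in (0:ℝ)..1, f (P, s)) :=
      fun P => (hasFDerivAt_pint f hf P).differentiableAt
    exact contDiff_zero.2 this.continuous
  | succ k ih =>
    push_cast
    rw [contDiff_succ_iff_fderiv_apply]
    refine ⟨fun P => (hasFDerivAt_pint f hf P).differentiableAt, by simp, fun v => ?_⟩
    simp only [fderiv_pint f hf]
    refine ih (fun q => fderiv ℝ f q (v, 0)) ?_
    exact (hf.fderiv_right (m := (⊤ : ℕ∞)) (by simp)).clm_apply contDiff_const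

lemma hasDerivAt_pderZ {n : ℕ} {f : (Fin n → ℝ) × ℝ × ℝ → ℝ} (hf : ContDiff ℝ (⊤ : ℕ∞) f)
    (μ : Fin n) (P : (Fin n → ℝ) × ℝ × ℝ) :
    pderZ n f μ P = fderiv ℝ f P (Pi.single μ 1, 0) := by
  have h1 : HasFDerivAt f (fderiv ℝ f P) (Function.update P.1 μ (P.1 μ), P.2) := by
    rw [Function.update_eq_self]
    exact (hf.differentiable (by simp) _).hasFDerivAt
  exact (h1.comp_hasDerivAt (P.1 μ)
    ((hasDerivAt_update P.1 μ (P.1 μ)).prodMk (hasDerivAt_const _ P.2))).deriv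

lemma pderX_eq {n : ℕ} {f : (Fin n → ℝ) × ℝ × ℝ → ℝ} (hf : ContDiff ℝ (⊤ : ℕ∞) f)
    (P : (Fin n → ℝ) × ℝ × ℝ) :
    pderX n f P = fderiv ℝ f P (0, 1, 0) := by
  have h1 : HasFDerivAt f (fderiv ℝ f P) (P.1, P.2.1, P.2.2) :=
    (hf.differentiable (by simp) _).hasFDerivAt
  exact (h1.comp_hasDerivAt (P.2.1)
    ((hasDerivAt_const _ P.1).prodMk ((hasDerivAt_id _).prodMk (hasDerivAt_const _ P.2.2)))).deriv

lemma pderT_eq {n : ℕ} {f : (Fin n → ℝ) × ℝ × ℝ → ℝ} (hf : ContDiff ℝ (⊤ : ℕ∞) f)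
    (P : (Fin n → ℝ) × ℝ × ℝ) :
    pderT n f P = fderiv ℝ f P (0, 0, 1) := by
  have h1 : HasFDerivAt f (fderiv ℝ f P) (P.1, P.2.1, P.2.2) :=
    (hf.differentiable (by simp) _).hasFDerivAt
  exact (h1.comp_hasDerivAt (P.2.2)
    ((hasDerivAt_const _ P.1).prodMk ((hasDerivAt_const _ P.2.1).prodMk (hasDerivAt_id _)))).deriv

lemma fderiv_vec {n : ℕ} (f : (Fin n → ℝ) × ℝ × ℝ → ℝ) (P : (Fin n → ℝ) × ℝ × ℝ)
    (z : Fin n → ℝ) :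
    fderiv ℝ f P (z, 0) = ∑ τ, z τ * fderiv ℝ f P (Pi.single τ 1, 0) := by
  have h : ((z, 0) : (Fin n → ℝ) × ℝ × ℝ) =
      ∑ τ, z τ • ((Pi.single τ 1, 0) : (Fin n → ℝ) × ℝ × ℝ) := by
    ext i
    · simp [Prod.fst_sum, Finset.sum_apply, Pi.single_apply]
    · simp [Prod.snd_sum]
    · simp [Prod.snd_sum]
  rw [h, map_sum]
  exact Finset.sum_congr rfl fun τ _ => by rw [map_smul, smul_eq_mul]

/-- the integrand of the homotopy operator -/
noncomputable def hInt {n : ℕ} (k : ℕ) (A : Fin n → (Fin n → ℝ) × ℝ × ℝ → ℝ)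
    (q : ((Fin n → ℝ) × ℝ × ℝ) × ℝ) : ℝ :=
  q.2 ^ k * ∑ τ, q.1.1 τ * A τ (q.2 • q.1.1, q.1.2)

lemma contDiff_hInt {n : ℕ} (k : ℕ) (A : Fin n → (Fin n → ℝ) × ℝ × ℝ → ℝ)
    (hA : ∀ τ, ContDiff ℝ (⊤ : ℕ∞) (A τ)) : ContDiff ℝ (⊤ : ℕ∞) (hInt k A) := by
  unfold hInt
  refine (contDiff_snd.pow k).mul (ContDiff.sum fun τ _ => ?_)
  refine ContDiff.mul (by fun_prop) ((hA τ).comp (by fun_prop))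

lemma fderiv_hInt {n : ℕ} (k : ℕ) (A : Fin n → (Fin n → ℝ) × ℝ × ℝ → ℝ)
    (hA : ∀ τ, ContDiff ℝ (⊤ : ℕ∞) (A τ)) (P : (Fin n → ℝ) × ℝ × ℝ) (s : ℝ) (μ : Fin n) :
    fderiv ℝ (hInt k A) (P, s) ((Pi.single μ 1, 0), 0) =
      s ^ k * (A μ (s • P.1, P.2) +
        s * ∑ τ, P.1 τ * fderiv ℝ (A τ) (s • P.1, P.2) (Pi.single μ 1, 0)) := by
  set v : ((Fin n → ℝ) × ℝ × ℝ) × ℝ := ((Pi.single μ 1, 0), 0) with hv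
  have hc : HasDerivAt (fun r : ℝ => (P, s) + r • v) v 0 := by
    simpa using ((hasDerivAt_id (0:ℝ)).smul_const v).const_add (P, s)
  have h0 : HasFDerivAt (hInt k A) (fderiv ℝ (hInt k A) (P, s)) ((P, s) + (0:ℝ) • v) := by
    simpa using ((contDiff_hInt k A hA).differentiable (by simp) (P, s)).hasFDerivAt
  have h1 := h0.comp_hasDerivAt 0 hc
  have hfun : (hInt k A ∘ fun r : ℝ => (P, s) + r • v) = fun r : ℝ =>
      s ^ k * ∑ τ, (P.1 τ + r * (Pi.single μ 1 : Fin n → ℝ) τ) *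
        A τ ((s • P.1, P.2) + r • (s • ((Pi.single μ 1 : Fin n → ℝ), (0 : ℝ × ℝ)))) := by
    funext r
    simp [hInt, hv, smul_smul, mul_comm]
  rw [hfun] at h1
  refine h1.unique ?_
  have hsum : ∀ τ, HasDerivAt (fun r : ℝ => (P.1 τ + r * (Pi.single μ 1 : Fin n → ℝ) τ) *
        A τ ((s • P.1, P.2) + r • (s • ((Pi.single μ 1 : Fin n → ℝ), (0 : ℝ × ℝ)))))
      ((Pi.single μ 1 : Fin n → ℝ) τ * A τ (s • P.1, P.2) +
        P.1 τ * (s * fderiv ℝ (A τ) (s • P.1, P.2) (Pi.single μ 1, 0))) 0 := by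
    intro τ
    have ha : HasDerivAt (fun r : ℝ => P.1 τ + r * (Pi.single μ 1 : Fin n → ℝ) τ)
        ((Pi.single μ 1 : Fin n → ℝ) τ) 0 := by
      simpa using ((hasDerivAt_id (0:ℝ)).mul_const ((Pi.single μ 1 : Fin n → ℝ) τ)).const_add (P.1 τ)
    have hc : HasDerivAt (fun r : ℝ => ((s • P.1, P.2) : (Fin n → ℝ) × ℝ × ℝ) +
        r • (s • ((Pi.single μ 1 : Fin n → ℝ), (0 : ℝ × ℝ))))
        (s • ((Pi.single μ 1 : Fin n → ℝ), (0 : ℝ × ℝ))) 0 := by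
      simpa using ((hasDerivAt_id (0:ℝ)).smul_const
        (s • ((Pi.single μ 1 : Fin n → ℝ), (0 : ℝ × ℝ)))).const_add (s • P.1, P.2)
    have hb0 : HasFDerivAt (A τ) (fderiv ℝ (A τ) (s • P.1, P.2))
        (((s • P.1, P.2) : (Fin n → ℝ) × ℝ × ℝ) +
        (0:ℝ) • (s • ((Pi.single μ 1 : Fin n → ℝ), (0 : ℝ × ℝ)))) := by
      rw [zero_smul, add_zero]
      exact ((hA τ).differentiable (by simp) _).hasFDerivAt
    have hb := hb0.comp_hasDerivAt 0 hc
    have := ha.mul hb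
    rw [map_smul] at this
    refine this.congr_deriv ?_
    simp only [Function.comp, zero_smul, add_zero, zero_mul, smul_eq_mul]
  have := (HasDerivAt.fun_sum (u := Finset.univ) fun τ _ => hsum τ).const_mul (s ^ k)
  refine this.congr_deriv ?_
  rw [Finset.sum_add_distrib, Finset.mul_sum]
  congr 2
  · simp [Pi.single_apply]
  · exact Finset.sum_congr rfl fun τ _ => by ring

lemma ftc_hom {n : ℕ} (k : ℕ) (f : (Fin n → ℝ) × ℝ × ℝ → ℝ)
    (hf : ContDiff ℝ (⊤ : ℕ∞) f) (P : (Fin n → ℝ) × ℝ × ℝ) :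
    ∫ s in (0:ℝ)..1, ((k + 1 : ℝ) * s ^ k * f (s • P.1, P.2) +
      s ^ (k + 1) * ∑ τ, P.1 τ * fderiv ℝ f (s • P.1, P.2) (Pi.single τ 1, 0)) = f P := by
  have hd : ∀ s : ℝ, HasDerivAt (fun s : ℝ => s ^ (k + 1) * f (s • P.1, P.2))
      ((k + 1 : ℝ) * s ^ k * f (s • P.1, P.2) +
      s ^ (k + 1) * ∑ τ, P.1 τ * fderiv ℝ f (s • P.1, P.2) (Pi.single τ 1, 0)) s := by
    intro s
    rw [← fderiv_vec]
    have h1 : HasDerivAt (fun s : ℝ => s ^ (k + 1)) ((k + 1 : ℝ) * s ^ k) s := by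
      simpa using hasDerivAt_pow (k + 1) s
    have h2 : HasDerivAt (fun s : ℝ => (s • P.1, P.2)) (P.1, (0 : ℝ × ℝ)) s := by
      have := ((hasDerivAt_id s).smul_const P.1).prodMk (hasDerivAt_const s P.2)
      simpa using this
    exact h1.mul ((hf.differentiable (by simp) (s • P.1, P.2)).hasFDerivAt.comp_hasDerivAt s h2)
  have hcd : Continuous (fderiv ℝ f) := hf.continuous_fderiv (by simp)
  have hcf := hf.continuous
  rw [intervalIntegral.integral_eq_sub_of_hasDerivAt (fun s _ => hd s)]
  · simp
  · apply Continuous.intervalIntegrable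
    fun_prop

/-- the homotopy operator -/
noncomputable def hOp {n : ℕ} (k : ℕ) (A : Fin n → (Fin n → ℝ) × ℝ × ℝ → ℝ)
    (P : (Fin n → ℝ) × ℝ × ℝ) : ℝ := ∫ s in (0:ℝ)..1, hInt k A (P, s)

lemma contDiff_hOp {n : ℕ} (k : ℕ) (A : Fin n → (Fin n → ℝ) × ℝ × ℝ → ℝ)
    (hA : ∀ τ, ContDiff ℝ (⊤ : ℕ∞) (A τ)) : ContDiff ℝ (⊤ : ℕ∞) (hOp k A) :=
  contDiff_pint _ (contDiff_hInt k A hA)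

lemma fderiv_hOp {n : ℕ} (k : ℕ) (A : Fin n → (Fin n → ℝ) × ℝ × ℝ → ℝ)
    (hA : ∀ τ, ContDiff ℝ (⊤ : ℕ∞) (A τ)) (P : (Fin n → ℝ) × ℝ × ℝ) (μ : Fin n) :
    fderiv ℝ (hOp k A) P (Pi.single μ 1, 0) = ∫ s in (0:ℝ)..1,
      s ^ k * (A μ (s • P.1, P.2) +
        s * ∑ τ, P.1 τ * fderiv ℝ (A τ) (s • P.1, P.2) (Pi.single μ 1, 0)) := by
  unfold hOp
  rw [fderiv_pint _ (contDiff_hInt k A hA)]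
  simp only [fderiv_hInt k A hA]

lemma poincare_one {n : ℕ} (A : Fin n → (Fin n → ℝ) × ℝ × ℝ → ℝ)
    (hA : ∀ τ, ContDiff ℝ (⊤ : ℕ∞) (A τ))
    (hcl : ∀ P μ ν, fderiv ℝ (A μ) P (Pi.single ν 1, 0) = fderiv ℝ (A ν) P (Pi.single μ 1, 0))
    (P : (Fin n → ℝ) × ℝ × ℝ) (μ : Fin n) :
    fderiv ℝ (hOp 0 A) P (Pi.single μ 1, 0) = A μ P := by
  rw [fderiv_hOp 0 A hA, ← ftc_hom 0 (A μ) (hA μ) P]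
  congr 1
  funext s
  simp only [hcl _ _ μ]
  simp

lemma poincare_two {n : ℕ} (M : (Fin n → ℝ) × ℝ × ℝ → Fin n → Fin n → ℝ)
    (hM : ∀ μ ν, ContDiff ℝ (⊤ : ℕ∞) (fun Q => M Q μ ν))
    (skewM : ∀ P (μ ν : Fin n), M P μ ν + M P ν μ = 0)
    (closedM : ∀ P (μ ν τ : Fin n),
      pderZ n (fun Q => M Q μ ν) τ P + pderZ n (fun Q => M Q ν τ) μ P
        + pderZ n (fun Q => M Q τ μ) ν P = 0)
    (P : (Fin n → ℝ) × ℝ × ℝ) (μ ν : Fin n) :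
    fderiv ℝ (hOp 1 (fun τ Q => M Q τ ν)) P (Pi.single μ 1, 0) -
      fderiv ℝ (hOp 1 (fun τ Q => M Q τ μ)) P (Pi.single ν 1, 0) = M P μ ν := by
  have hneg : ∀ a b, (fun Q => M Q a b) = fun Q => -(M Q b a) := fun a b => by
    funext Q; linarith [skewM Q a b]
  have hcl : ∀ Q τ, fderiv ℝ (fun Q => M Q τ ν) Q (Pi.single μ 1, 0) -
      fderiv ℝ (fun Q => M Q τ μ) Q (Pi.single ν 1, 0) =
      fderiv ℝ (fun Q => M Q μ ν) Q (Pi.single τ 1, 0) := by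
    intro Q τ
    have h := closedM Q μ ν τ
    rw [hasDerivAt_pderZ (hM _ _), hasDerivAt_pderZ (hM _ _), hasDerivAt_pderZ (hM _ _),
      hneg ν τ, fderiv_fun_neg] at h
    simp only [neg_apply] at h
    linarith
  rw [fderiv_hOp 1 _ (fun τ => hM τ ν), fderiv_hOp 1 _ (fun τ => hM τ μ),
    ← intervalIntegral.integral_sub]
  · rw [← ftc_hom 1 (fun Q => M Q μ ν) (hM μ ν) P]
    congr 1
    funext s
    simp only [← hcl, mul_sub, Finset.sum_sub_distrib]
    have := skewM (s • P.1, P.2) μ ν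
    push_cast
    linear_combination (-s) * this
  all_goals
    apply Continuous.intervalIntegrable
    have h1 := fun a b => (hM a b).continuous
    have h2 := fun a b => (hM a b).continuous_fderiv (by simp)
    refine (by fun_prop : Continuous fun s : ℝ => s ^ 1).mul (Continuous.add ?_ ?_)
    · exact (h1 _ _).comp (by fun_prop : Continuous fun s : ℝ => (s • P.1, P.2))
    · refine continuous_id.mul (continuous_finsetSum _ fun τ _ => continuous_const.mul ?_)
      exact ((h2 _ _).comp (by fun_prop : Continuous fun s : ℝ => (s • P.1, P.2))).clm_apply
        continuous_const

lemma fderiv_swap {E : Type*} [NormedAddCommGroup E] [NormedSpace ℝ E]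
    (f : E → ℝ) (hf : ContDiff ℝ (⊤ : ℕ∞) f) (P u v : E) :
    fderiv ℝ (fun Q => fderiv ℝ f Q u) P v = fderiv ℝ (fun Q => fderiv ℝ f Q v) P u := by
  have hd : DifferentiableAt ℝ (fderiv ℝ f) P :=
    (hf.fderiv_right (m := (⊤ : ℕ∞)) (by simp)).differentiable (by simp) P
  have key : ∀ w w', fderiv ℝ (fun Q => fderiv ℝ f Q w) P w' = fderiv ℝ (fderiv ℝ f) P w' w := by
    intro w w'
    rw [fderiv_clm_apply hd (differentiableAt_const _)]
    simp
  rw [key, key]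
  exact (hf.contDiffAt.isSymmSndFDerivAt (by
    rw [minSmoothness_of_isRCLikeNormedField]; exact WithTop.coe_le_coe.2 (le_top : (2 : ℕ∞) ≤ ⊤))).eq _ _

/-- (Sufficiency of the self-adjointness conditions.) If the
smooth matrix fields `M K : ℝⁿ × ℝ² → ℝ^{n×n}` and the smooth vector field
`D : ℝⁿ × ℝ² → ℝⁿ` satisfy skew-symmetry, the cyclic closedness identities in
`z`, and the mixed condition `∂M_{μν}/∂t + ∂K_{μν}/∂x = ∂D_μ/∂z^ν − ∂D_ν/∂z^μ`,
then there exist smooth `F G : ℝⁿ × ℝ² → ℝⁿ` and `B : ℝⁿ × ℝ² → ℝ` with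
`M_{μν} = ∂F_ν/∂z^μ − ∂F_μ/∂z^ν`, `K_{μν} = ∂G_ν/∂z^μ − ∂G_μ/∂z^ν` and
`D_μ = −(∂B/∂z^μ + ∂F_μ/∂t + ∂G_μ/∂x)`: the system
`M_{μν} z^ν_t + K_{μν} z^ν_x + D_μ = 0` is of multi-symplectic Birkhoffian
type. -/
theorem selfadjoint_implies_birkhoffian (n : ℕ) (hn : 1 ≤ n)
    (M K : (Fin n → ℝ) × ℝ × ℝ → Fin n → Fin n → ℝ)
    (D : (Fin n → ℝ) × ℝ × ℝ → Fin n → ℝ)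
    (hM : ContDiff ℝ (⊤ : ℕ∞) M) (hK : ContDiff ℝ (⊤ : ℕ∞) K) (hD : ContDiff ℝ (⊤ : ℕ∞) D)
    (skewM : ∀ P (μ ν : Fin n), M P μ ν + M P ν μ = 0)
    (skewK : ∀ P (μ ν : Fin n), K P μ ν + K P ν μ = 0)
    (closedM : ∀ P (μ ν τ : Fin n),
      pderZ n (fun Q => M Q μ ν) τ P + pderZ n (fun Q => M Q ν τ) μ P
        + pderZ n (fun Q => M Q τ μ) ν P = 0)
    (closedK : ∀ P (μ ν τ : Fin n),
      pderZ n (fun Q => K Q μ ν) τ P + pderZ n (fun Q => K Q ν τ) μ P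
        + pderZ n (fun Q => K Q τ μ) ν P = 0)
    (mixed : ∀ P (μ ν : Fin n),
      pderT n (fun Q => M Q μ ν) P + pderX n (fun Q => K Q μ ν) P =
        pderZ n (fun Q => D Q μ) ν P - pderZ n (fun Q => D Q ν) μ P) :
    ∃ (F G : (Fin n → ℝ) × ℝ × ℝ → Fin n → ℝ) (B : (Fin n → ℝ) × ℝ × ℝ → ℝ),
      ContDiff ℝ (⊤ : ℕ∞) F ∧ ContDiff ℝ (⊤ : ℕ∞) G ∧ ContDiff ℝ (⊤ : ℕ∞) B ∧
      ∀ P (μ ν : Fin n),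
        M P μ ν = pderZ n (fun Q => F Q ν) μ P - pderZ n (fun Q => F Q μ) ν P ∧
        K P μ ν = pderZ n (fun Q => G Q ν) μ P - pderZ n (fun Q => G Q μ) ν P ∧
        D P μ = -(pderZ n B μ P + pderT n (fun Q => F Q μ) P
          + pderX n (fun Q => G Q μ) P) := by
  have hM' : ∀ μ ν, ContDiff ℝ (⊤ : ℕ∞) (fun Q => M Q μ ν) := fun μ ν =>
    contDiff_pi.1 (contDiff_pi.1 hM μ) ν
  have hK' : ∀ μ ν, ContDiff ℝ (⊤ : ℕ∞) (fun Q => K Q μ ν) := fun μ ν =>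
    contDiff_pi.1 (contDiff_pi.1 hK μ) ν
  have hD' : ∀ μ, ContDiff ℝ (⊤ : ℕ∞) (fun Q => D Q μ) := fun μ => contDiff_pi.1 hD μ
  obtain ⟨F, hFdef⟩ : ∃ F : Fin n → (Fin n → ℝ) × ℝ × ℝ → ℝ,
    F = fun ν => hOp 1 (fun τ Q => M Q τ ν) := ⟨_, rfl⟩
  obtain ⟨G, hGdef⟩ : ∃ G : Fin n → (Fin n → ℝ) × ℝ × ℝ → ℝ,
    G = fun ν => hOp 1 (fun τ Q => K Q τ ν) := ⟨_, rfl⟩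
  have hF : ∀ ν, ContDiff ℝ (⊤ : ℕ∞) (F ν) := fun ν => by
    rw [hFdef]; exact contDiff_hOp 1 _ fun τ => hM' τ ν
  have hG : ∀ ν, ContDiff ℝ (⊤ : ℕ∞) (G ν) := fun ν => by
    rw [hGdef]; exact contDiff_hOp 1 _ fun τ => hK' τ ν
  have hFM : ∀ P μ ν, fderiv ℝ (F ν) P (Pi.single μ 1, 0) -
      fderiv ℝ (F μ) P (Pi.single ν 1, 0) = M P μ ν := fun P μ ν => by
    rw [hFdef]; exact poincare_two M hM' skewM closedM P μ ν
  have hGK : ∀ P μ ν, fderiv ℝ (G ν) P (Pi.single μ 1, 0) -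
      fderiv ℝ (G μ) P (Pi.single ν 1, 0) = K P μ ν := fun P μ ν => by
    rw [hGdef]; exact poincare_two K hK' skewK closedK P μ ν
  have dF : ∀ μ u, ContDiff ℝ (⊤ : ℕ∞) (fun Q => fderiv ℝ (F μ) Q u) := fun μ u =>
    ((hF μ).fderiv_right (m := (⊤ : ℕ∞)) (by simp)).clm_apply contDiff_const
  have dG : ∀ μ u, ContDiff ℝ (⊤ : ℕ∞) (fun Q => fderiv ℝ (G μ) Q u) := fun μ u =>
    ((hG μ).fderiv_right (m := (⊤ : ℕ∞)) (by simp)).clm_apply contDiff_const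
  have df : ∀ {f : (Fin n → ℝ) × ℝ × ℝ → ℝ}, ContDiff ℝ (⊤ : ℕ∞) f →
      ∀ P, DifferentiableAt ℝ f P := fun h P => h.differentiable (by simp) P
  obtain ⟨A, hAdef⟩ : ∃ A : Fin n → (Fin n → ℝ) × ℝ × ℝ → ℝ, A = fun μ Q =>
    D Q μ + fderiv ℝ (F μ) Q (0, 0, 1) + fderiv ℝ (G μ) Q (0, 1, 0) := ⟨_, rfl⟩
  have hA : ∀ μ, ContDiff ℝ (⊤ : ℕ∞) (A μ) := fun μ => by
    rw [hAdef]; exact ((hD' μ).add (dF μ _)).add (dG μ _)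
  have hAd : ∀ P μ u, fderiv ℝ (A μ) P u = fderiv ℝ (fun Q => D Q μ) P u +
      fderiv ℝ (fun Q => fderiv ℝ (F μ) Q u) P (0, 0, 1) +
      fderiv ℝ (fun Q => fderiv ℝ (G μ) Q u) P (0, 1, 0) := by
    intro P μ u
    rw [hAdef, fderiv_swap (F μ) (hF μ) P u, fderiv_swap (G μ) (hG μ) P u]
    have e : fderiv ℝ (fun Q => D Q μ + fderiv ℝ (F μ) Q (0, 0, 1) +
        fderiv ℝ (G μ) Q (0, 1, 0)) P = _ :=
      fderiv_fun_add (df ((hD' μ).add (dF μ _)) P) (df (dG μ _) P)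
    simp only
    rw [e, fderiv_fun_add (df (hD' μ) P) (df (dF μ _) P)]
    rfl
  have hcl : ∀ P μ ν, fderiv ℝ (A μ) P (Pi.single ν 1, 0) =
      fderiv ℝ (A ν) P (Pi.single μ 1, 0) := by
    intro P μ ν
    have h := mixed P μ ν
    rw [pderT_eq (hM' _ _), pderX_eq (hK' _ _), hasDerivAt_pderZ (hD' _),
      hasDerivAt_pderZ (hD' _)] at h
    simp only [← hFM, ← hGK] at h
    rw [fderiv_fun_sub (df (dF _ _) P) (df (dF _ _) P),
      fderiv_fun_sub (df (dG _ _) P) (df (dG _ _) P)] at h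
    simp only [sub_apply] at h
    rw [hAd, hAd]
    linarith
  refine ⟨fun Q μ => F μ Q, fun Q μ => G μ Q, fun Q => -(hOp 0 A Q), contDiff_pi.2 hF,
    contDiff_pi.2 hG, (contDiff_hOp 0 A hA).neg, fun P μ ν => ⟨?_, ?_, ?_⟩⟩
  · rw [hasDerivAt_pderZ (hF _), hasDerivAt_pderZ (hF _), hFM]
  · rw [hasDerivAt_pderZ (hG _), hasDerivAt_pderZ (hG _), hGK]
  · rw [hasDerivAt_pderZ (contDiff_hOp 0 A hA).neg, pderT_eq (hF _), pderX_eq (hG _),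
      fderiv_fun_neg]
    simp only [neg_apply]
    rw [poincare_one A hA hcl, hAdef]
    ring
end

section
/- Let n ≥ 1, let F, G : ℝⁿ × ℝ² → ℝⁿ and B : ℝⁿ × ℝ² → ℝ be smooth, let R = [x₁,x₂] × [t₁,t₂] be a compact rectangle with x₁ < x₂, t₁ < t₂, and let z : ℝ² → ℝⁿ be smooth. Then z satisfies the multi-symplectic Birkhoff equations at every interior point of R if and only if for every smooth η : ℝ² → ℝⁿ whose support is contained in the interior of R, the first variation of the Pfaffian action vanishes: d/dε |_{ε=0} ∫∫_R [Σ_ν F_ν(z+εη, x, t)(z+εη)^ν_t + Σ_ν G_ν(z+εη, x, t)(z+εη)^ν_x − B(z+εη, x, t)] dx dt = 0. -/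
open MeasureTheory intervalIntegral

lemma aux_pderZ {n : ℕ} {F : (Fin n → ℝ) × ℝ × ℝ → Fin n → ℝ} (hF : Differentiable ℝ F)
    (ν μ : Fin n) (P : (Fin n → ℝ) × ℝ × ℝ) :
    pderZ n (fun Q => F Q ν) μ P = fderiv ℝ F P (Pi.single μ 1, 0) ν := by
  unfold pderZ
  have h1 : HasDerivAt (fun s : ℝ => ((Function.update P.1 μ s, P.2) : (Fin n → ℝ) × ℝ × ℝ))
      (Pi.single μ 1, 0) (P.1 μ) :=
    (hasDerivAt_update P.1 μ (P.1 μ)).prodMk (hasDerivAt_const _ _)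
  have h2 : HasFDerivAt F (fderiv ℝ F P) ((Function.update P.1 μ (P.1 μ), P.2)) := by
    simpa using (hF P).hasFDerivAt
  exact (hasDerivAt_pi.1 (h2.comp_hasDerivAt (P.1 μ) h1) ν).deriv

lemma aux_pderZ' {n : ℕ} {F : (Fin n → ℝ) × ℝ × ℝ → ℝ} (hF : Differentiable ℝ F)
    (μ : Fin n) (P : (Fin n → ℝ) × ℝ × ℝ) :
    pderZ n F μ P = fderiv ℝ F P (Pi.single μ 1, 0) := by
  unfold pderZ
  have h1 : HasDerivAt (fun s : ℝ => ((Function.update P.1 μ s, P.2) : (Fin n → ℝ) × ℝ × ℝ))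
      (Pi.single μ 1, 0) (P.1 μ) :=
    (hasDerivAt_update P.1 μ (P.1 μ)).prodMk (hasDerivAt_const _ _)
  have h2 : HasFDerivAt F (fderiv ℝ F P) ((Function.update P.1 μ (P.1 μ), P.2)) := by
    simpa using (hF P).hasFDerivAt
  exact (h2.comp_hasDerivAt (P.1 μ) h1).deriv

lemma aux_pderT {n : ℕ} {F : (Fin n → ℝ) × ℝ × ℝ → Fin n → ℝ} (hF : Differentiable ℝ F)
    (ν : Fin n) (P : (Fin n → ℝ) × ℝ × ℝ) :
    pderT n (fun Q => F Q ν) P = fderiv ℝ F P (0, 0, 1) ν := by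
  unfold pderT
  have h1 : HasDerivAt (fun s : ℝ => ((P.1, P.2.1, s) : (Fin n → ℝ) × ℝ × ℝ))
      (0, 0, 1) (P.2.2) :=
    (hasDerivAt_const _ _).prodMk ((hasDerivAt_const _ _).prodMk (hasDerivAt_id _))
  have h2 : HasFDerivAt F (fderiv ℝ F P) (P.1, P.2.1, P.2.2) := (hF P).hasFDerivAt
  exact (hasDerivAt_pi.1 (h2.comp_hasDerivAt (P.2.2) h1) ν).deriv

lemma aux_pderX {n : ℕ} {F : (Fin n → ℝ) × ℝ × ℝ → Fin n → ℝ} (hF : Differentiable ℝ F)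
    (ν : Fin n) (P : (Fin n → ℝ) × ℝ × ℝ) :
    pderX n (fun Q => F Q ν) P = fderiv ℝ F P (0, 1, 0) ν := by
  unfold pderX
  have h1 : HasDerivAt (fun s : ℝ => ((P.1, s, P.2.2) : (Fin n → ℝ) × ℝ × ℝ))
      (0, 1, 0) (P.2.1) :=
    (hasDerivAt_const _ _).prodMk ((hasDerivAt_id _).prodMk (hasDerivAt_const _ _))
  have h2 : HasFDerivAt F (fderiv ℝ F P) (P.1, P.2.1, P.2.2) := (hF P).hasFDerivAt
  exact (hasDerivAt_pi.1 (h2.comp_hasDerivAt (P.2.1) h1) ν).deriv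

lemma aux_dt {n : ℕ} {y : ℝ × ℝ → Fin n → ℝ} (hy : Differentiable ℝ y) (ν : Fin n) (X T : ℝ) :
    deriv (fun s => y (X, s) ν) T = fderiv ℝ y (X, T) (0, 1) ν := by
  have h1 : HasDerivAt (fun s : ℝ => (X, s)) (0, 1) T :=
    (hasDerivAt_const _ _).prodMk (hasDerivAt_id _)
  exact (hasDerivAt_pi.1 ((hy (X, T)).hasFDerivAt.comp_hasDerivAt T h1) ν).deriv

lemma aux_dx {n : ℕ} {y : ℝ × ℝ → Fin n → ℝ} (hy : Differentiable ℝ y) (ν : Fin n) (X T : ℝ) :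
    deriv (fun s => y (s, T) ν) X = fderiv ℝ y (X, T) (1, 0) ν := by
  have h1 : HasDerivAt (fun s : ℝ => (s, T)) (1, 0) X :=
    (hasDerivAt_id _).prodMk (hasDerivAt_const _ _)
  exact (hasDerivAt_pi.1 ((hy (X, T)).hasFDerivAt.comp_hasDerivAt X h1) ν).deriv

/-- differentiation under the integral over a compact set -/
lemma aux_param {K : Set (ℝ × ℝ)} (hK : IsCompact K) {f : ℝ × ℝ × ℝ → ℝ}
    (hf : ContDiff ℝ 1 f) :
    HasDerivAt (fun ε : ℝ => ∫ P in K, f (ε, P))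
      (∫ P in K, fderiv ℝ f (0, P) (1, 0)) 0 := by
  have hc : Continuous fun q : ℝ × ℝ × ℝ => fderiv ℝ f q (1, 0) :=
    (hf.continuous_fderiv one_ne_zero).clm_apply continuous_const
  obtain ⟨C, hC⟩ := ((isCompact_Icc (a := (-1 : ℝ)) (b := 1)).prod hK).exists_bound_of_continuousOn
    hc.continuousOn
  have hfc := hf.continuous
  refine (hasDerivAt_integral_of_dominated_loc_of_deriv_le
    (F := fun (ε : ℝ) P => f (ε, P)) (F' := fun (ε : ℝ) P => fderiv ℝ f (ε, P) (1, 0))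
    (s := Set.Icc (-1) 1) (bound := fun _ => C) (μ := volume.restrict K)
    (Icc_mem_nhds (by norm_num) (by norm_num)) ?_ ?_ ?_ ?_ ?_ ?_).2
  · exact Filter.Eventually.of_forall fun ε =>
      (Continuous.aestronglyMeasurable (by fun_prop))
  · exact ContinuousOn.integrableOn_compact hK (Continuous.continuousOn (by fun_prop))
  · exact (hc.comp (by fun_prop : Continuous fun P : ℝ × ℝ => ((0 : ℝ), P))).aestronglyMeasurable
  · filter_upwards [ae_restrict_mem hK.measurableSet] with P hP ε hε
    exact hC (ε, P) ⟨hε, hP⟩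
  · exact integrableOn_const hK.measure_lt_top.ne
  · refine Filter.Eventually.of_forall fun P ε _ => ?_
    exact ((hf.differentiable one_ne_zero) (ε, P)).hasFDerivAt.comp_hasDerivAt ε
      ((hasDerivAt_id ε).prodMk (hasDerivAt_const _ _))

lemma aux_iter {x₁ x₂ t₁ t₂ : ℝ} (hx : x₁ ≤ x₂) (ht : t₁ ≤ t₂) {f : ℝ × ℝ → ℝ}
    (hf : Continuous f) :
    ∫ T in t₁..t₂, ∫ X in x₁..x₂, f (X, T) = ∫ P in Set.Icc x₁ x₂ ×ˢ Set.Icc t₁ t₂, f P := by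
  rw [Measure.volume_eq_prod, ← setIntegral_prod_swap, setIntegral_prod]
  · simp only [intervalIntegral.integral_of_le hx, intervalIntegral.integral_of_le ht,
      integral_Icc_eq_integral_Ioc, Prod.swap]
  · exact ContinuousOn.integrableOn_compact (isCompact_Icc.prod isCompact_Icc)
      (Continuous.continuousOn (by fun_prop))

lemma aux_int {x₁ x₂ t₁ t₂ : ℝ} : interior (Set.Icc x₁ x₂ ×ˢ Set.Icc t₁ t₂) =
    Set.Ioo x₁ x₂ ×ˢ Set.Ioo t₁ t₂ := by
  rw [interior_prod_eq, interior_Icc, interior_Icc]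

lemma aux_div {x₁ x₂ t₁ t₂ : ℝ} (hx : x₁ ≤ x₂) (ht : t₁ ≤ t₂) {u v : ℝ × ℝ → ℝ}
    (hu : ContDiff ℝ 1 u) (hv : ContDiff ℝ 1 v)
    (hu0 : ∀ P ∉ Set.Ioo x₁ x₂ ×ˢ Set.Ioo t₁ t₂, u P = 0)
    (hv0 : ∀ P ∉ Set.Ioo x₁ x₂ ×ˢ Set.Ioo t₁ t₂, v P = 0) :
    ∫ P in Set.Icc x₁ x₂ ×ˢ Set.Icc t₁ t₂, (fderiv ℝ u P (1, 0) + fderiv ℝ v P (0, 1)) = 0 := by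
  have := integral_divergence_prod_Icc_of_hasFDerivAt_of_le u v (fderiv ℝ u) (fderiv ℝ v)
    (x₁, t₁) (x₂, t₂) ⟨hx, ht⟩ hu.continuous.continuousOn hv.continuous.continuousOn
    (fun P _ => (hu.differentiable one_ne_zero P).hasFDerivAt)
    (fun P _ => (hv.differentiable one_ne_zero P).hasFDerivAt)
    (ContinuousOn.integrableOn_compact isCompact_Icc (Continuous.continuousOn
      (((hu.continuous_fderiv one_ne_zero).clm_apply continuous_const).add
      ((hv.continuous_fderiv one_ne_zero).clm_apply continuous_const))))
  rw [Set.Icc_prod_eq] at this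
  refine this.trans ?_
  have e1 : ∀ y, u (x₂, y) = 0 := fun y => hu0 _ (by simp)
  have e2 : ∀ y, u (x₁, y) = 0 := fun y => hu0 _ (by simp)
  have e3 : ∀ y, v (y, t₂) = 0 := fun y => hv0 _ (by simp)
  have e4 : ∀ y, v (y, t₁) = 0 := fun y => hv0 _ (by simp)
  simp [e1, e2, e3, e4]

/-- linear expansion in the coordinates -/
lemma aux_lin {n : ℕ} {E : Type*} [NormedAddCommGroup E] [NormedSpace ℝ E]
    (L : (Fin n → ℝ) × ℝ × ℝ →L[ℝ] E) (a : Fin n → ℝ) :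
    L (a, 0) = ∑ μ, a μ • L (Pi.single μ 1, 0) := by
  have : (a, (0 : ℝ × ℝ)) = ∑ μ, a μ • ((Pi.single μ 1 : Fin n → ℝ), (0 : ℝ × ℝ)) := by
    refine Prod.ext ?_ ?_
    · rw [Prod.fst_sum]
      simpa using pi_eq_sum_univ' a
    · rw [Prod.snd_sum]; simp
  rw [this, map_sum]; simp only [map_smul]

/-- one half of the Euler-Lagrange identity -/
lemma aux_alg {n : ℕ} (L : (Fin n → ℝ) × ℝ × ℝ →L[ℝ] (Fin n → ℝ)) (a b : Fin n → ℝ)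
    (d : ℝ × ℝ) :
    ∑ ν, L (b, 0) ν * a ν - ∑ ν, L (a, d) ν * b ν =
      ∑ μ, ((∑ ν, (L (Pi.single μ 1, 0) ν - L (Pi.single ν 1, 0) μ) * a ν)
        - L (0, d) μ) * b μ := by
  have h1 : L (a, d) = L (a, 0) + L (0, d) := by rw [← map_add]; simp
  rw [h1, aux_lin L a, aux_lin L b]
  simp only [Finset.sum_apply, Pi.add_apply, Pi.smul_apply, smul_eq_mul, sub_mul, add_mul,
    Finset.sum_mul, Finset.sum_add_distrib, Finset.sum_sub_distrib]
  rw [Finset.sum_comm]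
  have e : ∑ x, ∑ i, b x * L (Pi.single x 1, 0) i * a i
      = ∑ x, ∑ i, L (Pi.single x 1, 0) i * a i * b x := by
    refine Finset.sum_congr rfl fun _ _ => Finset.sum_congr rfl fun _ _ => by ring
  have e' : ∑ x, ∑ i, a i * L (Pi.single i 1, 0) x * b x
      = ∑ x, ∑ i, L (Pi.single i 1, 0) x * a i * b x := by
    refine Finset.sum_congr rfl fun _ _ => Finset.sum_congr rfl fun _ _ => by ring
  rw [e, e']; ring

/-- the Euler-Lagrange expression -/
noncomputable def auxE {n : ℕ} (F G : (Fin n → ℝ) × ℝ × ℝ → Fin n → ℝ)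
    (B : (Fin n → ℝ) × ℝ × ℝ → ℝ) (z : ℝ × ℝ → Fin n → ℝ) (μ : Fin n) (P : ℝ × ℝ) : ℝ :=
  (∑ ν, (fderiv ℝ F (z P, P) (Pi.single μ 1, 0) ν - fderiv ℝ F (z P, P) (Pi.single ν 1, 0) μ)
      * fderiv ℝ z P (0, 1) ν)
  + (∑ ν, (fderiv ℝ G (z P, P) (Pi.single μ 1, 0) ν - fderiv ℝ G (z P, P) (Pi.single ν 1, 0) μ)
      * fderiv ℝ z P (1, 0) ν)
  - (fderiv ℝ B (z P, P) (Pi.single μ 1, 0) + fderiv ℝ F (z P, P) (0, 0, 1) μ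
      + fderiv ℝ G (z P, P) (0, 1, 0) μ)

/-- the integrand along the variation -/
noncomputable def auxL {n : ℕ} (F G : (Fin n → ℝ) × ℝ × ℝ → Fin n → ℝ)
    (B : (Fin n → ℝ) × ℝ × ℝ → ℝ) (z η : ℝ × ℝ → Fin n → ℝ) (q : ℝ × ℝ × ℝ) : ℝ :=
  (∑ ν, F (z q.2 + q.1 • η q.2, q.2) ν * (fderiv ℝ z q.2 (0, 1) + q.1 • fderiv ℝ η q.2 (0, 1)) ν)
  + (∑ ν, G (z q.2 + q.1 • η q.2, q.2) ν
      * (fderiv ℝ z q.2 (1, 0) + q.1 • fderiv ℝ η q.2 (1, 0)) ν)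
  - B (z q.2 + q.1 • η q.2, q.2)

lemma aux_smooth_fderiv {E E' : Type*} [NormedAddCommGroup E] [NormedSpace ℝ E]
    [NormedAddCommGroup E'] [NormedSpace ℝ E'] {f : E → E'}
    (hf : ContDiff ℝ (⊤ : ℕ∞) f) (v : E) :
    ContDiff ℝ 1 (fun P => fderiv ℝ f P v) :=
  (hf.fderiv_right (m := 1) (by norm_cast)).clm_apply contDiff_const

lemma auxL_contDiff {n : ℕ} {F G : (Fin n → ℝ) × ℝ × ℝ → Fin n → ℝ}
    {B : (Fin n → ℝ) × ℝ × ℝ → ℝ} {z η : ℝ × ℝ → Fin n → ℝ}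
    (hF : ContDiff ℝ (⊤ : ℕ∞) F) (hG : ContDiff ℝ (⊤ : ℕ∞) G) (hB : ContDiff ℝ (⊤ : ℕ∞) B)
    (hz : ContDiff ℝ (⊤ : ℕ∞) z) (hη : ContDiff ℝ (⊤ : ℕ∞) η) :
    ContDiff ℝ 1 (auxL F G B z η) := by
  have h1 := fun v => aux_smooth_fderiv hz v
  have h2 := fun v => aux_smooth_fderiv hη v
  have hF' : ContDiff ℝ 1 F := hF.of_le (by norm_cast)
  have hG' : ContDiff ℝ 1 G := hG.of_le (by norm_cast)
  have hB' : ContDiff ℝ 1 B := hB.of_le (by norm_cast)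
  have hz' : ContDiff ℝ 1 z := hz.of_le (by norm_cast)
  have hη' : ContDiff ℝ 1 η := hη.of_le (by norm_cast)
  have hw : ContDiff ℝ 1 (fun q : ℝ × ℝ × ℝ => (z q.2 + q.1 • η q.2, q.2)) := by
    exact ((hz'.comp contDiff_snd).add (contDiff_fst.smul (hη'.comp contDiff_snd))).prodMk
      contDiff_snd
  have hv : ∀ v, ContDiff ℝ 1 (fun q : ℝ × ℝ × ℝ =>
      fderiv ℝ z q.2 v + q.1 • fderiv ℝ η q.2 v) := fun v =>
    ((h1 v).comp contDiff_snd).add (contDiff_fst.smul ((h2 v).comp contDiff_snd))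
  unfold auxL
  refine ((ContDiff.sum fun ν _ => ?_).add (ContDiff.sum fun ν _ => ?_)).sub (hB'.comp hw)
  · exact (contDiff_pi.1 (hF'.comp hw) ν).mul (contDiff_pi.1 (hv _) ν)
  · exact (contDiff_pi.1 (hG'.comp hw) ν).mul (contDiff_pi.1 (hv _) ν)

lemma auxE_continuous {n : ℕ} {F G : (Fin n → ℝ) × ℝ × ℝ → Fin n → ℝ}
    {B : (Fin n → ℝ) × ℝ × ℝ → ℝ} {z : ℝ × ℝ → Fin n → ℝ}
    (hF : ContDiff ℝ (⊤ : ℕ∞) F) (hG : ContDiff ℝ (⊤ : ℕ∞) G) (hB : ContDiff ℝ (⊤ : ℕ∞) B)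
    (hz : ContDiff ℝ (⊤ : ℕ∞) z) (μ : Fin n) :
    Continuous (auxE F G B z μ) := by
  have h1 := fun v => (aux_smooth_fderiv hz v).continuous
  have hw : Continuous fun P => (z P, P) := hz.continuous.prodMk continuous_id
  have h2 := fun v => (aux_smooth_fderiv hF v).continuous.comp hw
  have h3 := fun v => (aux_smooth_fderiv hG v).continuous.comp hw
  have h4 := fun v => (aux_smooth_fderiv hB v).continuous.comp hw
  have h1' := fun v ν => continuous_pi_iff.1 (h1 v) ν
  have h2' := fun v ν => continuous_pi_iff.1 (h2 v) ν
  have h3' := fun v ν => continuous_pi_iff.1 (h3 v) ν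
  unfold auxE
  refine ((continuous_finsetSum _ fun ν _ => ?_).add (continuous_finsetSum _ fun ν _ => ?_)).sub
    (((h4 _).add (h2' _ _)).add (h3' _ _))
  · exact ((h2' _ _).sub (h2' _ _)).mul (h1' _ _)
  · exact ((h3' _ _).sub (h3' _ _)).mul (h1' _ _)

/-- derivative of `∑ F_ν η_ν` -/
lemma aux_u {n : ℕ} {F : (Fin n → ℝ) × ℝ × ℝ → Fin n → ℝ} {z η : ℝ × ℝ → Fin n → ℝ}
    (hF : Differentiable ℝ F) (hz : Differentiable ℝ z) (hη : Differentiable ℝ η)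
    (P d : ℝ × ℝ) :
    fderiv ℝ (fun P => ∑ ν, F (z P, P) ν * η P ν) P d =
      ∑ ν, (fderiv ℝ F (z P, P) (fderiv ℝ z P d, d) ν * η P ν
        + F (z P, P) ν * fderiv ℝ η P d ν) := by
  have h1 : HasFDerivAt (fun P => F (z P, P)) ((fderiv ℝ F (z P, P)).comp
      ((fderiv ℝ z P).prod (ContinuousLinearMap.id ℝ (ℝ × ℝ)))) P :=
    HasFDerivAt.comp (f := fun P => (z P, P)) P (hF (z P, P)).hasFDerivAt
      ((hz P).hasFDerivAt.prodMk (hasFDerivAt_id P))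
  have h2 := hasFDerivAt_pi'.1 h1
  have h3 := hasFDerivAt_pi'.1 (hη P).hasFDerivAt
  have h4 := HasFDerivAt.fun_sum (u := Finset.univ) fun ν _ => (h2 ν).fun_mul (h3 ν)
  rw [h4.fderiv]
  simp only [ContinuousLinearMap.sum_apply]
  refine Finset.sum_congr rfl fun ν _ => ?_
  simp
  ring

lemma aux_half {n : ℕ} {F : (Fin n → ℝ) × ℝ × ℝ → Fin n → ℝ} {z η : ℝ × ℝ → Fin n → ℝ}
    (hF : Differentiable ℝ F) (P d : ℝ × ℝ) :
    HasDerivAt (fun ε : ℝ => ∑ ν, F (z P + ε • η P, P) ν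
        * (fderiv ℝ z P d + ε • fderiv ℝ η P d) ν)
      (∑ ν, (fderiv ℝ F (z P, P) (η P, 0) ν * fderiv ℝ z P d ν
        + F (z P, P) ν * fderiv ℝ η P d ν)) 0 := by
  have h0 : ∀ a b : Fin n → ℝ, HasDerivAt (fun ε : ℝ => a + ε • b) b 0 := fun a b => by
    simpa using ((hasDerivAt_id (0 : ℝ)).smul_const b).const_add a
  have h1 : HasDerivAt (fun ε : ℝ => (z P + ε • η P, P)) (η P, 0) 0 :=
    (h0 _ _).prodMk (hasDerivAt_const _ _)
  have h2 : HasFDerivAt F (fderiv ℝ F (z P, P)) (z P + (0 : ℝ) • η P, P) := by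
    simpa using (hF (z P, P)).hasFDerivAt
  have h3 := hasDerivAt_pi.1 (h2.comp_hasDerivAt (0 : ℝ) h1)
  have h4 := hasDerivAt_pi.1 (h0 (fderiv ℝ z P d) (fderiv ℝ η P d))
  have h5 := HasDerivAt.fun_sum (u := Finset.univ) fun ν _ => (h3 ν).mul (h4 ν)
  refine HasDerivAt.congr_deriv h5 ?_
  refine Finset.sum_congr rfl fun ν _ => ?_
  simp

lemma aux_EL {n : ℕ} {F G : (Fin n → ℝ) × ℝ × ℝ → Fin n → ℝ}
    {B : (Fin n → ℝ) × ℝ × ℝ → ℝ} {z η : ℝ × ℝ → Fin n → ℝ}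
    (hF : ContDiff ℝ (⊤ : ℕ∞) F) (hG : ContDiff ℝ (⊤ : ℕ∞) G) (hB : ContDiff ℝ (⊤ : ℕ∞) B)
    (hz : ContDiff ℝ (⊤ : ℕ∞) z) (hη : ContDiff ℝ (⊤ : ℕ∞) η) (P : ℝ × ℝ) :
    fderiv ℝ (auxL F G B z η) (0, P) (1, 0) = (∑ μ, auxE F G B z μ P * η P μ)
      + (fderiv ℝ (fun P => ∑ ν, G (z P, P) ν * η P ν) P (1, 0)
        + fderiv ℝ (fun P => ∑ ν, F (z P, P) ν * η P ν) P (0, 1)) := by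
  have hF' : Differentiable ℝ F := hF.differentiable (by simp)
  have hG' : Differentiable ℝ G := hG.differentiable (by simp)
  have hB' : Differentiable ℝ B := hB.differentiable (by simp)
  have hz' : Differentiable ℝ z := hz.differentiable (by simp)
  have hη' : Differentiable ℝ η := hη.differentiable (by simp)
  have hL := (((auxL_contDiff hF hG hB hz hη).differentiable one_ne_zero)
    (0, P)).hasFDerivAt.comp_hasDerivAt (0 : ℝ) ((hasDerivAt_id (0 : ℝ)).prodMk
      (hasDerivAt_const (0 : ℝ) P))
  have hBd : HasDerivAt (fun ε : ℝ => B (z P + ε • η P, P)) (fderiv ℝ B (z P, P) (η P, 0)) 0 := by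
    have h0 : HasDerivAt (fun ε : ℝ => z P + ε • η P) (η P) 0 := by
      simpa using ((hasDerivAt_id (0 : ℝ)).smul_const (η P)).const_add (z P)
    have h1 : HasDerivAt (fun ε : ℝ => (z P + ε • η P, P)) (η P, 0) 0 :=
      h0.prodMk (hasDerivAt_const _ _)
    have h2 : HasFDerivAt B (fderiv ℝ B (z P, P)) (z P + (0 : ℝ) • η P, P) := by
      simpa using (hB' (z P, P)).hasFDerivAt
    exact h2.comp_hasDerivAt (0 : ℝ) h1
  have hD := ((aux_half (z := z) (η := η) hF' P (0, 1)).add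
    (aux_half (z := z) (η := η) hG' P (1, 0))).sub hBd
  have heq := hL.unique hD
  rw [heq, aux_u hF' hz' hη', aux_u hG' hz' hη', aux_lin (fderiv ℝ B (z P, P))]
  have a1 := aux_alg (fderiv ℝ F (z P, P)) (fderiv ℝ z P (0, 1)) (η P) (0, 1)
  have a2 := aux_alg (fderiv ℝ G (z P, P)) (fderiv ℝ z P (1, 0)) (η P) (1, 0)
  have a3 : ∑ μ, auxE F G B z μ P * η P μ =
      (∑ μ, ((∑ ν, (fderiv ℝ F (z P, P) (Pi.single μ 1, 0) ν
          - fderiv ℝ F (z P, P) (Pi.single ν 1, 0) μ) * fderiv ℝ z P (0, 1) ν)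
        - fderiv ℝ F (z P, P) (0, 0, 1) μ) * η P μ)
      + (∑ μ, ((∑ ν, (fderiv ℝ G (z P, P) (Pi.single μ 1, 0) ν
          - fderiv ℝ G (z P, P) (Pi.single ν 1, 0) μ) * fderiv ℝ z P (1, 0) ν)
        - fderiv ℝ G (z P, P) (0, 1, 0) μ) * η P μ)
      - ∑ μ, η P μ • fderiv ℝ B (z P, P) (Pi.single μ 1, 0) := by
    rw [← Finset.sum_add_distrib, ← Finset.sum_sub_distrib]
    refine Finset.sum_congr rfl fun μ _ => ?_
    unfold auxE
    rw [smul_eq_mul]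
    ring
  rw [a3, ← a1, ← a2]
  simp only [Finset.sum_add_distrib]
  ring

lemma aux_first {n : ℕ} {F G : (Fin n → ℝ) × ℝ × ℝ → Fin n → ℝ}
    {B : (Fin n → ℝ) × ℝ × ℝ → ℝ} {z η : ℝ × ℝ → Fin n → ℝ}
    (hF : ContDiff ℝ (⊤ : ℕ∞) F) (hG : ContDiff ℝ (⊤ : ℕ∞) G) (hB : ContDiff ℝ (⊤ : ℕ∞) B)
    (hz : ContDiff ℝ (⊤ : ℕ∞) z) (hη : ContDiff ℝ (⊤ : ℕ∞) η)
    {x₁ x₂ t₁ t₂ : ℝ} (hx : x₁ < x₂) (ht : t₁ < t₂)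
    (hs : tsupport η ⊆ interior (Set.Icc x₁ x₂ ×ˢ Set.Icc t₁ t₂)) :
    HasDerivAt (fun ε : ℝ => ∫ P in Set.Icc x₁ x₂ ×ˢ Set.Icc t₁ t₂, auxL F G B z η (ε, P))
      (∫ P in Set.Icc x₁ x₂ ×ˢ Set.Icc t₁ t₂, ∑ μ, auxE F G B z μ P * η P μ) 0 := by
  have hK : IsCompact (Set.Icc x₁ x₂ ×ˢ Set.Icc t₁ t₂) := isCompact_Icc.prod isCompact_Icc
  have h := aux_param hK (auxL_contDiff hF hG hB hz hη)
  have hu : ∀ F : (Fin n → ℝ) × ℝ × ℝ → Fin n → ℝ, ContDiff ℝ (⊤ : ℕ∞) F →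
      ContDiff ℝ 1 (fun P => ∑ ν, F (z P, P) ν * η P ν) := fun F hF => by
    have hw : ContDiff ℝ (⊤ : ℕ∞) fun P => (z P, P) := hz.prodMk contDiff_id
    refine ContDiff.of_le (n := (⊤ : ℕ∞)) ?_ (by norm_cast)
    exact ContDiff.sum fun ν _ => (contDiff_pi.1 (hF.comp hw) ν).mul (contDiff_pi.1 hη ν)
  have hu0 : ∀ F : (Fin n → ℝ) × ℝ × ℝ → Fin n → ℝ, ∀ P ∉ Set.Ioo x₁ x₂ ×ˢ Set.Ioo t₁ t₂,
      (fun P => ∑ ν, F (z P, P) ν * η P ν) P = 0 := fun F P hP => by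
    have : η P = 0 := image_eq_zero_of_notMem_tsupport fun h' => hP (aux_int ▸ hs h')
    simp [this]
  have hd := aux_div hx.le ht.le (hu G hG) (hu F hF) (hu0 G) (hu0 F)
  simp only [aux_EL hF hG hB hz hη] at h
  rw [MeasureTheory.integral_add, hd, add_zero] at h
  · exact h
  · refine ContinuousOn.integrableOn_compact hK (Continuous.continuousOn ?_)
    exact continuous_finsetSum _ fun ν _ => (auxE_continuous hF hG hB hz ν).mul
      (continuous_pi_iff.1 hη.continuous ν)
  · refine ContinuousOn.integrableOn_compact hK (Continuous.continuousOn ?_)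
    exact (((hu G hG).continuous_fderiv one_ne_zero).clm_apply continuous_const).add
      (((hu F hF).continuous_fderiv one_ne_zero).clm_apply continuous_const)

/-- (Variational principle for the Pfaffian action.) For smooth
`F G : ℝⁿ × ℝ² → ℝⁿ`, `B : ℝⁿ × ℝ² → ℝ`, a compact rectangle
`R = [x₁,x₂] × [t₁,t₂]` and a smooth `z : ℝ² → ℝⁿ`, the field `z` satisfies the
multi-symplectic Birkhoff equations at every interior point of `R` iff for
every smooth variation `η` supported in the interior of `R`, the first
variation of the Pfaffian action
`∫∫_R [Σ_ν F_ν z^ν_t + Σ_ν G_ν z^ν_x − B] dx dt` vanishes. -/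
theorem birkhoff_iff_first_variation_vanishes (n : ℕ) (hn : 1 ≤ n)
    (F G : (Fin n → ℝ) × ℝ × ℝ → Fin n → ℝ) (B : (Fin n → ℝ) × ℝ × ℝ → ℝ)
    (hF : ContDiff ℝ (⊤ : ℕ∞) F) (hG : ContDiff ℝ (⊤ : ℕ∞) G) (hB : ContDiff ℝ (⊤ : ℕ∞) B)
    (x₁ x₂ t₁ t₂ : ℝ) (hx : x₁ < x₂) (ht : t₁ < t₂)
    (z : ℝ × ℝ → Fin n → ℝ) (hz : ContDiff ℝ (⊤ : ℕ∞) z) :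
    let R : Set (ℝ × ℝ) := Set.Icc x₁ x₂ ×ˢ Set.Icc t₁ t₂
    let action : (ℝ × ℝ → Fin n → ℝ) → ℝ := fun y =>
      ∫ T in t₁..t₂, ∫ X in x₁..x₂,
        ((∑ ν, F (y (X, T), X, T) ν * deriv (fun s => y (X, s) ν) T)
          + (∑ ν, G (y (X, T), X, T) ν * deriv (fun s => y (s, T) ν) X)
          - B (y (X, T), X, T))
    ((∀ P ∈ interior R, ∀ μ : Fin n,
        (∑ ν, (pderZ n (fun Q => F Q ν) μ (z P, P.1, P.2)
                - pderZ n (fun Q => F Q μ) ν (z P, P.1, P.2))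
              * deriv (fun s => z (P.1, s) ν) P.2)
        + (∑ ν, (pderZ n (fun Q => G Q ν) μ (z P, P.1, P.2)
                - pderZ n (fun Q => G Q μ) ν (z P, P.1, P.2))
              * deriv (fun s => z (s, P.2) ν) P.1)
        - (pderZ n B μ (z P, P.1, P.2) + pderT n (fun Q => F Q μ) (z P, P.1, P.2)
            + pderX n (fun Q => G Q μ) (z P, P.1, P.2)) = 0)
      ↔
      (∀ η : ℝ × ℝ → Fin n → ℝ, ContDiff ℝ (⊤ : ℕ∞) η → tsupport η ⊆ interior R →
        deriv (fun ε : ℝ => action (fun P => z P + ε • η P)) 0 = 0)) := by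
  intro R action
  have hF' : Differentiable ℝ F := hF.differentiable (by simp)
  have hG' : Differentiable ℝ G := hG.differentiable (by simp)
  have hB' : Differentiable ℝ B := hB.differentiable (by simp)
  have hz' : Differentiable ℝ z := hz.differentiable (by simp)
  have hact : ∀ η : ℝ × ℝ → Fin n → ℝ, ContDiff ℝ (⊤ : ℕ∞) η → tsupport η ⊆ interior R →
      deriv (fun ε : ℝ => action (fun P => z P + ε • η P)) 0
        = ∫ P in R, ∑ μ, auxE F G B z μ P * η P μ := by
    intro η hη hs
    have hη' : Differentiable ℝ η := hη.differentiable (by simp)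
    rw [← (aux_first hF hG hB hz hη hx ht hs).deriv]
    congr 1
    funext ε
    have hy : Differentiable ℝ (fun P => z P + ε • η P) := hz'.add (hη'.const_smul ε)
    have hfd : ∀ P d, fderiv ℝ (fun P => z P + ε • η P) P d
        = fderiv ℝ z P d + ε • fderiv ℝ η P d := fun P d => by
      rw [((hz' P).hasFDerivAt.fun_add ((hη' P).hasFDerivAt.fun_const_smul ε)).fderiv]
      simp
    rw [← aux_iter (f := fun P => auxL F G B z η (ε, P)) hx.le ht.le
      ((auxL_contDiff hF hG hB hz hη).continuous.comp
      (by fun_prop : Continuous fun P : ℝ × ℝ => (ε, P)))]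
    simp only [action]
    have e1 : ∀ (X T : ℝ) (ν : Fin n), deriv (fun s => (z (X, s) + ε • η (X, s)) ν) T
        = (fderiv ℝ z (X, T) (0, 1) + ε • fderiv ℝ η (X, T) (0, 1)) ν := fun X T ν => by
      rw [← hfd, ← aux_dt hy]
    have e2 : ∀ (X T : ℝ) (ν : Fin n), deriv (fun s => (z (s, T) + ε • η (s, T)) ν) X
        = (fderiv ℝ z (X, T) (1, 0) + ε • fderiv ℝ η (X, T) (1, 0)) ν := fun X T ν => by
      rw [← hfd, ← aux_dx hy]
    simp only [e1, e2]
    rfl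
  have hE : ∀ P : ℝ × ℝ, ∀ μ : Fin n,
        (∑ ν, (pderZ n (fun Q => F Q ν) μ (z P, P.1, P.2)
                - pderZ n (fun Q => F Q μ) ν (z P, P.1, P.2))
              * deriv (fun s => z (P.1, s) ν) P.2)
        + (∑ ν, (pderZ n (fun Q => G Q ν) μ (z P, P.1, P.2)
                - pderZ n (fun Q => G Q μ) ν (z P, P.1, P.2))
              * deriv (fun s => z (s, P.2) ν) P.1)
        - (pderZ n B μ (z P, P.1, P.2) + pderT n (fun Q => F Q μ) (z P, P.1, P.2)
            + pderX n (fun Q => G Q μ) (z P, P.1, P.2)) = auxE F G B z μ P := by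
    intro P μ
    simp only [aux_pderZ hF', aux_pderZ hG', aux_pderZ' hB', aux_pderT hF', aux_pderX hG',
      aux_dt hz', aux_dx hz']
    rfl
  simp only [hE]
  constructor
  · intro h η hη hs
    rw [hact η hη hs]
    refine integral_eq_zero_of_ae (Filter.Eventually.of_forall fun P => ?_)
    by_cases hP : P ∈ interior R
    · simp [h P hP]
    · have : η P = 0 := image_eq_zero_of_notMem_tsupport fun h' => hP (hs h')
      simp [this]
  · intro h P hP μ
    have hc := auxE_continuous hF hG hB hz μ
    have hae : ∀ᵐ P, P ∈ interior R → auxE F G B z μ P = 0 := by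
      refine isOpen_interior.ae_eq_zero_of_integral_contDiff_smul_eq_zero
        (hc.locallyIntegrable.locallyIntegrableOn _) fun g hg _ hgs => ?_
      have hη : ContDiff ℝ (⊤ : ℕ∞) (fun P => g P • (Pi.single μ 1 : Fin n → ℝ)) :=
        hg.smul contDiff_const
      have hs : tsupport (fun P => g P • (Pi.single μ 1 : Fin n → ℝ)) ⊆ interior R :=
        (closure_mono (Function.support_smul_subset_left _ _)).trans hgs
      have h0 := h _ hη hs
      rw [hact _ hη hs] at h0
      rw [← h0, ← setIntegral_eq_integral_of_forall_compl_eq_zero (s := R)]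
      · congr 1
        funext P
        simp [Pi.single_apply, mul_comm]
      · intro P hP
        have : g P = 0 :=
          image_eq_zero_of_notMem_tsupport fun h' => hP (interior_subset (hgs h'))
        simp [this]
    exact Measure.eqOn_open_of_ae_eq (f := auxE F G B z μ) (g := fun _ => 0) (μ := volume)
      ((ae_restrict_iff' isOpen_interior.measurableSet).2 hae)
      isOpen_interior hc.continuousOn continuousOn_const hP
end
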